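/- For every path graph P with at least three nodes, the pure discrete Morse complex M_p(P) is collapsible. -/

import Mathlib

open Finset

/-- Arc of the Hasse diagram of the simplicial complex `K`: from `g` to `f` whenever
`f ⊂ g` and `dim g = dim f + 1`. -/
def HasseArc {V : Type} [DecidableEq V] (K : Finset (Finset V)) (g f : Finset V) : Prop :=
  g ∈ K ∧ f ∈ K ∧ f ⊂ g ∧ g.card = f.card + 1

/-- `M` is a matching: no two distinct pairs of `M` share an endpoint. -/
def IsMatchingPairs {α : Type} (M : Set (α × α)) : Prop :=
  ∀ p ∈ M, ∀ q ∈ M, p ≠ q → p.1 ≠ q.1 ∧ p.1 ≠ q.2 ∧ p.2 ≠ q.1 ∧ p.2 ≠ q.2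

/-- One step of the Hasse diagram of `K` with the arcs belonging to `M` reversed. -/
def MorseStep {V : Type} [DecidableEq V] (K : Finset (Finset V))
    (M : Set (Finset V × Finset V)) (x y : Finset V) : Prop :=
  (HasseArc K x y ∧ (x, y) ∉ M) ∨ ((y, x) ∈ M ∧ HasseArc K y x)

/-- A (discrete) Morse matching on the complex `K`: a matching in the Hasse diagram of `K`
such that reversing exactly the arcs of the matching yields a directed graph with no
directed cycle. -/
def IsMorseMatching {V : Type} [DecidableEq V] (K : Finset (Finset V))
    (M : Set (Finset V × Finset V)) : Prop :=
  (∀ p ∈ M, HasseArc K p.1 p.2) ∧ IsMatchingPairs M ∧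
    ∀ s : Finset V, ¬ Relation.TransGen (MorseStep K M) s s

/-- A finite graph regarded as a one-dimensional simplicial complex: faces are the
vertices (as singletons) and the edges (as two-element sets). -/
noncomputable def graphComplex {V : Type} [Fintype V] [DecidableEq V] (G : SimpleGraph V) :
    Finset (Finset V) := by
  classical
  exact Finset.univ.filter fun s => (∃ v, s = {v}) ∨ ∃ u v, G.Adj u v ∧ s = {u, v}

/-- The discrete Morse complex of the complex `K`: its faces are the nonempty Morse
matchings on `K`. -/
noncomputable def morseComplex {V : Type} [Fintype V] [DecidableEq V]
    (K : Finset (Finset V)) : Finset (Finset (Finset V × Finset V)) := by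
  classical
  exact Finset.univ.filter fun M => M.Nonempty ∧ IsMorseMatching K ↑M

/-- The pure discrete Morse complex of `K`: the subcomplex of the discrete Morse complex
generated by its faces of maximal dimension. -/
noncomputable def pureMorseComplex {V : Type} [Fintype V] [DecidableEq V]
    (K : Finset (Finset V)) : Finset (Finset (Finset V × Finset V)) := by
  classical
  exact Finset.univ.filter fun M => M.Nonempty ∧ ∃ M' ∈ morseComplex K,
    (∀ N ∈ morseComplex K, N.card ≤ M'.card) ∧ M ⊆ M'

/-- An elementary collapse: `f` is a free face of `K` (properly contained in exactly one
face `g` of `K`) and `K'` is obtained from `K` by removing the pair `{f, g}`. -/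
def CollapseStep {V : Type} [DecidableEq V] (K K' : Finset (Finset V)) : Prop :=
  ∃ f g, f ∈ K ∧ g ∈ K ∧ f ⊂ g ∧ (∀ h ∈ K, f ⊂ h → h = g) ∧ K' = K \ {f, g}

/-- A complex is collapsible if some finite sequence of elementary collapses reduces it
to a complex consisting of a single vertex. -/
def Collapsible {V : Type} [DecidableEq V] (K : Finset (Finset V)) : Prop :=
  ∃ v : V, Relation.ReflTransGen CollapseStep K {({v} : Finset V)}

/-- If the star of the vertex `a` is closed under inserting and deleting another vertex `x`,
then the whole open star of `a` can be collapsed away. -/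
lemma collapse_open_star {α : Type} [DecidableEq α] {a x : α} (hax : a ≠ x)
    (K : Finset (Finset α)) (hins : ∀ h ∈ K, a ∈ h → insert x h ∈ K)
    (hers : ∀ h ∈ K, a ∈ h → h.erase x ∈ K) :
    Relation.ReflTransGen CollapseStep K (K.filter fun h => a ∉ h) := by
  induction K using Finset.strongInduction with
  | H K ih =>
    by_cases hK : ∀ h ∈ K, a ∉ h
    · rw [Finset.filter_true_of_mem hK]
    · push Not at hK
      obtain ⟨h₀, hh₀, ha₀⟩ := hK
      obtain ⟨f, hf, hmax⟩ := Finset.exists_max_image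
        (K.filter fun h => a ∈ h ∧ x ∉ h) Finset.card
        ⟨h₀.erase x, by simp [hers h₀ hh₀ ha₀, ha₀, hax]⟩
      simp only [Finset.mem_filter] at hf hmax
      obtain ⟨hfK, haf, hxf⟩ := hf
      have hstep : CollapseStep K (K \ {f, insert x f}) := by
        refine ⟨f, insert x f, hfK, hins f hfK haf, Finset.ssubset_insert hxf, ?_, rfl⟩
        intro h hh hfh
        have hah : a ∈ h := hfh.1 haf
        have hsub : f ⊆ h.erase x := Finset.subset_erase.2 ⟨hfh.1, hxf⟩
        have heq : f = h.erase x := Finset.eq_of_subset_of_card_le hsub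
          (hmax _ ⟨hers h hh hah, by simp [hah, hax], by simp⟩)
        have hxh : x ∈ h := by
          by_contra hx
          rw [Finset.erase_eq_of_notMem hx] at heq
          exact hfh.ne heq
        rw [heq, Finset.insert_erase hxh]
      have hlt : K \ {f, insert x f} ⊂ K := by
        refine ⟨Finset.sdiff_subset, fun hsub => ?_⟩
        have := hsub hfK
        simp at this
      have hfilter : (K \ {f, insert x f}).filter (fun h => a ∉ h)
          = K.filter fun h => a ∉ h := by
        ext h
        simp only [Finset.mem_filter, Finset.mem_sdiff, Finset.mem_insert,
          Finset.mem_singleton]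
        grind
      rw [← hfilter]
      refine Relation.ReflTransGen.head hstep (ih _ hlt ?_ ?_)
      · intro h hh hah
        simp only [Finset.mem_sdiff, Finset.mem_insert, Finset.mem_singleton] at hh ⊢
        refine ⟨hins h hh.1 hah, ?_⟩
        rintro (h1 | h1)
        · exact hxf (h1 ▸ Finset.mem_insert_self x h)
        · apply hh.2
          by_cases hxh : x ∈ h
          · right; rwa [Finset.insert_eq_of_mem hxh] at h1
          · left
            rw [← Finset.erase_insert hxh, h1, Finset.erase_insert hxf]
      · intro h hh hah
        simp only [Finset.mem_sdiff, Finset.mem_insert, Finset.mem_singleton] at hh ⊢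
        refine ⟨hers h hh.1 hah, ?_⟩
        rintro (h1 | h1)
        · apply hh.2
          by_cases hxh : x ∈ h
          · right; rw [← h1, Finset.insert_erase hxh]
          · left; rwa [Finset.erase_eq_of_notMem hxh] at h1
        · exact Finset.notMem_erase x h (h1 ▸ Finset.mem_insert_self x f)

/-- A cone collapses to its apex. -/
lemma collapse_cone {α : Type} [Fintype α] [DecidableEq α] (x : α)
    (K : Finset (Finset α)) (hne : ∀ h ∈ K, h.Nonempty) (hx : {x} ∈ K)
    (hins : ∀ h ∈ K, insert x h ∈ K)
    (hers : ∀ h ∈ K, (h.erase x).Nonempty → h.erase x ∈ K) :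
    Relation.ReflTransGen CollapseStep K {({x} : Finset α)} := by
  have key : ∀ T : Finset α, x ∉ T →
      Relation.ReflTransGen CollapseStep K (K.filter fun h => Disjoint T h) := by
    intro T
    induction T using Finset.induction_on with
    | empty =>
      intro _
      rw [Finset.filter_true_of_mem fun h _ => Finset.disjoint_empty_left h]
    | insert a T _ ih =>
      intro hxT
      simp only [Finset.mem_insert, not_or] at hxT
      refine (ih hxT.2).trans ?_
      have heq : K.filter (fun h => Disjoint (insert a T) h)
          = (K.filter fun h => Disjoint T h).filter fun h => a ∉ h := by
        ext h
        simp only [Finset.mem_filter, Finset.disjoint_insert_left]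
        tauto
      rw [heq]
      refine collapse_open_star (Ne.symm hxT.1) _ ?_ ?_
      · intro h hh _
        simp only [Finset.mem_filter, Finset.disjoint_insert_right] at hh ⊢
        exact ⟨hins h hh.1, hxT.2, hh.2⟩
      · intro h hh hah
        simp only [Finset.mem_filter] at hh ⊢
        exact ⟨hers h hh.1 ⟨a, Finset.mem_erase.2 ⟨Ne.symm hxT.1, hah⟩⟩,
          hh.2.mono_right (Finset.erase_subset x h)⟩
  have hT := key (Finset.univ.erase x) (by simp)
  have heq : K.filter (fun h => Disjoint (Finset.univ.erase x) h) = {({x} : Finset α)} := by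
    ext h
    simp only [Finset.mem_filter, Finset.mem_singleton]
    constructor
    · rintro ⟨hh, hd⟩
      refine Finset.eq_singleton_iff_nonempty_unique_mem.2 ⟨hne h hh, fun y hy => ?_⟩
      by_contra hyx
      exact Finset.disjoint_left.1 hd (by simp [hyx]) hy
    · rintro rfl
      exact ⟨hx, by simp⟩
  rwa [heq] at hT

/-- The complex generated by the sets `F 0, …, F j`. -/
def generatedComplex {α : Type} [Fintype α] [DecidableEq α] (F : ℕ → Finset α) (j : ℕ) :
    Finset (Finset α) :=
  Finset.univ.filter fun h => h.Nonempty ∧ ∃ k ≤ j, h ⊆ F k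

lemma mem_generatedComplex {α : Type} [Fintype α] [DecidableEq α] {F : ℕ → Finset α} {j : ℕ}
    {h : Finset α} : h ∈ generatedComplex F j ↔ h.Nonempty ∧ ∃ k ≤ j, h ⊆ F k := by
  simp [generatedComplex]

/-- If each generator `F (k + 1)` adds the new vertex `a k` and otherwise lies in `F k`, then
the later generators can be collapsed away towards `a 0`, and the remaining complex is a cone
with apex `x`. -/
lemma generatedComplex_collapsible {α : Type} [Fintype α] [DecidableEq α] (F : ℕ → Finset α)
    (a : ℕ → α) (x : α) (m : ℕ) (hm : 1 ≤ m) (hnew : ∀ j k, j ≤ k → k < m → a k ∉ F j)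
    (hold : ∀ k < m, (F (k + 1)).erase (a k) ⊆ F k)
    (hzero : ∀ k < m, a 0 ∈ F (k + 1)) (hx₀ : x ∈ F 0) (hx₁ : x ∈ F 1) :
    Collapsible (generatedComplex F m) := by
  refine ⟨x, ?_⟩
  have step : ∀ k, 1 ≤ k → k < m → Relation.ReflTransGen CollapseStep
      (generatedComplex F (k + 1)) (generatedComplex F k) := by
    intro k hk hkm
    have heq : generatedComplex F k
        = (generatedComplex F (k + 1)).filter fun h => a k ∉ h := by
      ext h
      simp only [Finset.mem_filter, mem_generatedComplex]
      constructor
      · rintro ⟨hne, j, hj, hsub⟩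
        exact ⟨⟨hne, j, by omega, hsub⟩, fun ha => hnew j k hj hkm (hsub ha)⟩
      · rintro ⟨⟨hne, j, hj, hsub⟩, ha⟩
        refine ⟨hne, ?_⟩
        rcases Nat.lt_or_ge k j with hlt | hle
        · obtain rfl : j = k + 1 := by omega
          exact ⟨k, le_rfl, (Finset.subset_erase.2 ⟨hsub, ha⟩).trans (hold k hkm)⟩
        · exact ⟨j, hle, hsub⟩
    have hne : a k ≠ a 0 := by
      intro h
      have := hzero (k - 1) (by omega)
      rw [Nat.sub_add_cancel hk] at this
      exact hnew k k le_rfl hkm (h ▸ this)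
    rw [heq]
    refine collapse_open_star hne _ ?_ ?_
    · intro h hh hah
      rw [mem_generatedComplex] at hh ⊢
      obtain ⟨-, j, hj, hsub⟩ := hh
      have hkj : k < j := by
        by_contra hcon
        exact hnew j k (by omega) hkm (hsub hah)
      obtain rfl : j = k + 1 := by omega
      exact ⟨Finset.insert_nonempty _ _, k + 1, le_rfl,
        Finset.insert_subset (hzero k hkm) hsub⟩
    · intro h hh hah
      rw [mem_generatedComplex] at hh ⊢
      obtain ⟨-, j, hj, hsub⟩ := hh
      exact ⟨⟨a k, Finset.mem_erase.2 ⟨hne, hah⟩⟩, j, hj, (Finset.erase_subset _ _).trans hsub⟩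
  have toOne : ∀ k, 1 ≤ k → k ≤ m → Relation.ReflTransGen CollapseStep
      (generatedComplex F k) (generatedComplex F 1) := by
    intro k hk
    induction k, hk using Nat.le_induction with
    | base => exact fun _ => Relation.ReflTransGen.refl
    | succ k hk ih => exact fun hkm => (step k hk (by omega)).trans (ih (by omega))
  have hxF : ∀ k ≤ 1, x ∈ F k := by
    intro k hk
    interval_cases k <;> assumption
  refine (toOne m hm le_rfl).trans (collapse_cone x _ ?_ ?_ ?_ ?_)
  · exact fun h hh => (mem_generatedComplex.1 hh).1
  · exact mem_generatedComplex.2 ⟨by simp, 0, by omega, by simpa using hx₀⟩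
  · intro h hh
    obtain ⟨-, k, hk, hsub⟩ := mem_generatedComplex.1 hh
    exact mem_generatedComplex.2
      ⟨Finset.insert_nonempty _ _, k, hk, Finset.insert_subset (hxF k hk) hsub⟩
  · intro h hh hne
    obtain ⟨-, k, hk, hsub⟩ := mem_generatedComplex.1 hh
    exact mem_generatedComplex.2 ⟨hne, k, hk, (Finset.erase_subset _ _).trans hsub⟩

/-- The `i`-th edge of the path with `m` edges. -/
def pathEdge {m : ℕ} (i : Fin m) : Finset (Fin (m + 1)) := {i.castSucc, i.succ}

lemma card_pathEdge {m : ℕ} (i : Fin m) : (pathEdge i).card = 2 :=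
  Finset.card_pair (Fin.castSucc_lt_succ).ne

lemma pathEdge_injective {m : ℕ} : Function.Injective (pathEdge (m := m)) := by
  intro i j hij
  have h₁ : i.castSucc ∈ pathEdge j := hij ▸ by simp [pathEdge]
  have h₂ : i.succ ∈ pathEdge j := hij ▸ by simp [pathEdge]
  simp only [pathEdge, Finset.mem_insert, Finset.mem_singleton, Fin.ext_iff, Fin.val_castSucc,
    Fin.val_succ] at h₁ h₂
  ext
  omega

/-- The arc matching the `i`-th edge of a path with its endpoint away from node `k`. -/
def pathArc {m : ℕ} (k : ℕ) (i : Fin m) : Finset (Fin (m + 1)) × Finset (Fin (m + 1)) :=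
  (pathEdge i, if i.val < k then {i.castSucc} else {i.succ})

/-- The maximum Morse matching of a path in which node `k` is critical. -/
def pathMatching (m k : ℕ) : Finset (Finset (Fin (m + 1)) × Finset (Fin (m + 1))) :=
  Finset.univ.image (pathArc (m := m) k)

lemma pathArc_injective {m : ℕ} (k : ℕ) : Function.Injective (pathArc (m := m) k) :=
  fun _ _ h => pathEdge_injective (congrArg Prod.fst h)

lemma card_pathMatching (m k : ℕ) : (pathMatching m k).card = m := by
  rw [pathMatching, Finset.card_image_of_injective _ (pathArc_injective k), Finset.card_univ,
    Fintype.card_fin]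

lemma mem_graphComplex_pathGraph {m : ℕ} {s : Finset (Fin (m + 1))} :
    s ∈ graphComplex (SimpleGraph.pathGraph (m + 1)) ↔
      (∃ v, s = {v}) ∨ ∃ i : Fin m, s = pathEdge i := by
  simp only [graphComplex, Finset.mem_filter, Finset.mem_univ, true_and,
    SimpleGraph.pathGraph_adj]
  refine or_congr_right ⟨?_, ?_⟩
  · have edge : ∀ u v : Fin (m + 1), u.val + 1 = v.val →
        ∃ i : Fin m, ({u, v} : Finset (Fin (m + 1))) = pathEdge i := by
      intro u v huv
      refine ⟨⟨u, by omega⟩, ?_⟩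
      have hu : Fin.castSucc (⟨u, by omega⟩ : Fin m) = u := rfl
      have hv : Fin.succ (⟨u, by omega⟩ : Fin m) = v := Fin.ext huv
      rw [pathEdge, hu, hv]
    rintro ⟨u, v, huv | huv, rfl⟩
    · exact edge u v huv
    · rw [Finset.pair_comm]
      exact edge v u huv
  · rintro ⟨i, rfl⟩
    exact ⟨i.castSucc, i.succ, by simp, rfl⟩

lemma hasseArc_pathGraph_iff {m : ℕ} {g f : Finset (Fin (m + 1))} :
    HasseArc (graphComplex (SimpleGraph.pathGraph (m + 1))) g f ↔
      ∃ i : Fin m, g = pathEdge i ∧ (f = {i.castSucc} ∨ f = {i.succ}) := by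
  simp only [HasseArc, mem_graphComplex_pathGraph]
  constructor
  · rintro ⟨⟨v, rfl⟩ | ⟨i, rfl⟩, ⟨w, rfl⟩ | ⟨j, rfl⟩, hss, hcard⟩
    · simp at hcard
    · simp [card_pathEdge] at hcard
    · have := hss.1 (Finset.mem_singleton_self w)
      simp only [pathEdge, Finset.mem_insert, Finset.mem_singleton] at this
      exact ⟨i, rfl, by simpa using this⟩
    · simp [card_pathEdge] at hcard
  · rintro ⟨i, rfl, hf⟩
    have hcard : (pathEdge i).card = f.card + 1 := by
      rcases hf with rfl | rfl <;> simp [card_pathEdge]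
    refine ⟨Or.inr ⟨i, rfl⟩, Or.inl ?_, ?_, hcard⟩
    · rcases hf with rfl | rfl <;> exact ⟨_, rfl⟩
    · refine (Finset.ssubset_iff_subset_ne).2 ⟨?_, fun h => by rw [h] at hcard; omega⟩
      rcases hf with rfl | rfl <;> simp [pathEdge]

/-- The position of a face of a path along its Hasse diagram. -/
def pathPosition {m : ℕ} (s : Finset (Fin (m + 1))) : ℤ :=
  (2 * ∑ v ∈ s, (v.val : ℤ)) / s.card

lemma pathPosition_singleton {m : ℕ} (v : Fin (m + 1)) : pathPosition {v} = 2 * v.val := by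
  simp [pathPosition]

lemma pathPosition_pathEdge {m : ℕ} (i : Fin m) : pathPosition (pathEdge i) = 2 * i.val + 1 := by
  rw [pathPosition, card_pathEdge, pathEdge, Finset.sum_pair (Fin.castSucc_lt_succ).ne]
  simp only [Fin.val_castSucc, Fin.val_succ]
  push_cast
  omega

lemma morseStep_pathMatching_lt {m k : ℕ} {s t : Finset (Fin (m + 1))}
    (h : MorseStep (graphComplex (SimpleGraph.pathGraph (m + 1))) ↑(pathMatching m k) s t) :
    |pathPosition t - 2 * k| < |pathPosition s - 2 * k| := by
  rcases h with ⟨harc, hM⟩ | ⟨hM, -⟩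
  · obtain ⟨i, rfl, hf⟩ := hasseArc_pathGraph_iff.1 harc
    have hne : t ≠ (pathArc k i).2 := by
      rintro rfl
      exact hM (by simp only [pathMatching, Finset.coe_image]; exact ⟨i, by simp, rfl⟩)
    rcases hf with rfl | rfl
    · have hik : ¬ i.val < k := fun hik => hne (by simp [pathArc, hik])
      rw [pathPosition_singleton, pathPosition_pathEdge, Fin.val_castSucc]
      grind
    · have hik : i.val < k := by
        by_contra hik
        exact hne (by simp [pathArc, hik])
      rw [pathPosition_singleton, pathPosition_pathEdge, Fin.val_succ]
      push_cast
      grind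
  · simp only [pathMatching, Finset.coe_image, Set.mem_image] at hM
    obtain ⟨i, -, hi⟩ := hM
    obtain ⟨rfl, rfl⟩ := Prod.ext_iff.1 hi
    simp only [pathArc]
    split_ifs with hik
    · rw [pathPosition_singleton, pathPosition_pathEdge, Fin.val_castSucc]
      grind
    · rw [pathPosition_singleton, pathPosition_pathEdge, Fin.val_succ]
      push_cast
      grind

lemma isMorseMatching_pathMatching (m k : ℕ) :
    IsMorseMatching (graphComplex (SimpleGraph.pathGraph (m + 1))) ↑(pathMatching m k) := by
  refine ⟨?_, ?_, ?_⟩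
  · intro p hp
    obtain ⟨i, -, rfl⟩ := Finset.mem_image.1 (Finset.mem_coe.1 hp)
    refine hasseArc_pathGraph_iff.2 ⟨i, rfl, ?_⟩
    simp only [pathArc]
    split_ifs <;> simp
  · intro p hp q hq hpq
    obtain ⟨i, -, rfl⟩ := Finset.mem_image.1 (Finset.mem_coe.1 hp)
    obtain ⟨j, -, rfl⟩ := Finset.mem_image.1 (Finset.mem_coe.1 hq)
    have hij : i.val ≠ j.val := fun h => hpq (by rw [Fin.ext h])
    have hcard : ∀ i : Fin m, (pathArc k i).2.card = 1 := by
      intro i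
      simp only [pathArc]
      split_ifs <;> simp
    refine ⟨fun h => hij (congrArg Fin.val (pathEdge_injective h)), fun h => ?_, fun h => ?_,
      fun h => ?_⟩
    · have := congrArg Finset.card h
      rw [hcard, pathArc, card_pathEdge] at this
      omega
    · have := congrArg Finset.card h
      rw [hcard, pathArc, card_pathEdge] at this
      omega
    · simp only [pathArc] at h
      split_ifs at h <;>
        simp only [Finset.singleton_inj, Fin.ext_iff, Fin.val_castSucc, Fin.val_succ] at h <;>
        omega
  · intro s hs
    have hlt : ∀ t, Relation.TransGen
        (MorseStep (graphComplex (SimpleGraph.pathGraph (m + 1))) ↑(pathMatching m k)) s t →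
        |pathPosition t - 2 * k| < |pathPosition s - 2 * k| := by
      intro t ht
      induction ht with
      | single h => exact morseStep_pathMatching_lt h
      | tail _ h ih => exact (morseStep_pathMatching_lt h).trans ih
    exact lt_irrefl _ (hlt s hs)

section
variable {m : ℕ} {M : Finset (Finset (Fin (m + 1)) × Finset (Fin (m + 1)))}

lemma image_fst_subset_of_isMorseMatching
    (hM : IsMorseMatching (graphComplex (SimpleGraph.pathGraph (m + 1))) ↑M) :
    M.image Prod.fst ⊆ Finset.univ.image (pathEdge (m := m)) := by
  intro g hg
  obtain ⟨p, hp, rfl⟩ := Finset.mem_image.1 hg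
  obtain ⟨i, hi, -⟩ := hasseArc_pathGraph_iff.1 (hM.1 p hp)
  exact Finset.mem_image.2 ⟨i, Finset.mem_univ i, hi.symm⟩

lemma card_image_fst_of_isMorseMatching
    (hM : IsMorseMatching (graphComplex (SimpleGraph.pathGraph (m + 1))) ↑M) :
    (M.image Prod.fst).card = M.card := by
  refine Finset.card_image_of_injOn fun p hp q hq h => ?_
  by_contra hpq
  exact (hM.2.1 p hp q hq hpq).1 h

lemma card_image_pathEdge : (Finset.univ.image (pathEdge (m := m))).card = m := by
  rw [Finset.card_image_of_injective _ pathEdge_injective, Finset.card_univ, Fintype.card_fin]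

lemma card_le_of_isMorseMatching
    (hM : IsMorseMatching (graphComplex (SimpleGraph.pathGraph (m + 1))) ↑M) :
    M.card ≤ m := by
  rw [← card_image_fst_of_isMorseMatching hM]
  exact (Finset.card_le_card (image_fst_subset_of_isMorseMatching hM)).trans
    card_image_pathEdge.le

lemma exists_eq_pathMatching
    (hM : IsMorseMatching (graphComplex (SimpleGraph.pathGraph (m + 1))) ↑M)
    (hcard : M.card = m) : ∃ k ≤ m, M = pathMatching m k := by
  have himage := Finset.eq_of_subset_of_card_le (image_fst_subset_of_isMorseMatching hM)
    (by rw [card_image_fst_of_isMorseMatching hM, card_image_pathEdge, hcard])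
  have hmem : ∀ i : Fin m, (pathEdge i, {i.castSucc}) ∈ M ∨ (pathEdge i, {i.succ}) ∈ M := by
    intro i
    have hi : pathEdge i ∈ M.image Prod.fst := by
      rw [himage]
      exact Finset.mem_image_of_mem _ (Finset.mem_univ i)
    obtain ⟨⟨g, f⟩, hp, rfl⟩ := Finset.mem_image.1 hi
    obtain ⟨j, hj, hf⟩ := hasseArc_pathGraph_iff.1 (hM.1 _ hp)
    obtain rfl := pathEdge_injective hj
    rcases hf with rfl | rfl
    · exact Or.inl hp
    · exact Or.inr hp
  have hnext : ∀ i j : Fin m, i.val + 1 = j.val → (pathEdge i, {i.succ}) ∈ M →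
      (pathEdge j, {j.succ}) ∈ M := by
    intro i j hij hi
    refine (hmem j).resolve_left fun hj => ?_
    have hne : i ≠ j := fun h => by rw [h] at hij; omega
    refine (hM.2.1 _ hi _ hj fun h => hne (pathEdge_injective (congrArg Prod.fst h))).2.2.2 ?_
    have hsucc : i.succ = j.castSucc := Fin.ext (by simpa using hij)
    exact Finset.singleton_inj.2 hsucc
  have hmono : ∀ i : Fin m, (pathEdge i, {i.succ}) ∈ M → ∀ d (h : i.val + d < m),
      (pathEdge ⟨i.val + d, h⟩, {Fin.succ ⟨i.val + d, h⟩}) ∈ M := by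
    intro i hi d
    induction d with
    | zero => exact fun _ => hi
    | succ d ih => exact fun h => hnext ⟨i.val + d, by omega⟩ _ rfl (ih (by omega))
  have hex : ∃ k, ∀ i : Fin m, k ≤ i.val → (pathEdge i, {i.succ}) ∈ M :=
    ⟨m, fun i hi => absurd i.isLt (by omega)⟩
  classical
  refine ⟨Nat.find hex, Nat.find_min' hex fun i hi => absurd i.isLt (by omega), ?_⟩
  refine (Finset.eq_of_subset_of_card_le ?_ (by rw [card_pathMatching, hcard])).symm
  intro p hp
  obtain ⟨i, -, rfl⟩ := Finset.mem_image.1 hp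
  simp only [pathArc]
  split_ifs with hik
  · refine (hmem i).resolve_right fun hi => Nat.find_min hex hik fun j hij => ?_
    have := hmono i hi (j.val - i.val) (by omega)
    have hj : (⟨i.val + (j.val - i.val), by omega⟩ : Fin m) = j := Fin.ext (by simp; omega)
    rwa [hj] at this
  · exact Nat.find_spec hex i (by omega)

end

lemma pureMorseComplex_pathGraph {m : ℕ} (hm : 1 ≤ m) :
    pureMorseComplex (graphComplex (SimpleGraph.pathGraph (m + 1))) =
      generatedComplex (pathMatching m) m := by
  have hmem : ∀ k, pathMatching m k ∈
      morseComplex (graphComplex (SimpleGraph.pathGraph (m + 1))) := by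
    intro k
    simp only [morseComplex, Finset.mem_filter, Finset.mem_univ, true_and]
    exact ⟨Finset.card_pos.1 (by rw [card_pathMatching]; omega),
      isMorseMatching_pathMatching m k⟩
  have hmorse : ∀ N ∈ morseComplex (graphComplex (SimpleGraph.pathGraph (m + 1))),
      IsMorseMatching (graphComplex (SimpleGraph.pathGraph (m + 1))) ↑N := by
    intro N hN
    simp only [morseComplex, Finset.mem_filter] at hN
    exact hN.2.2
  ext h
  rw [mem_generatedComplex]
  simp only [pureMorseComplex, Finset.mem_filter, Finset.mem_univ, true_and]
  refine and_congr_right fun _ => ⟨?_, ?_⟩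
  · rintro ⟨N, hN, hmax, hsub⟩
    have hcard : N.card = m := le_antisymm (card_le_of_isMorseMatching (hmorse N hN))
      ((card_pathMatching m 0).symm.le.trans (hmax _ (hmem 0)))
    obtain ⟨k, hk, rfl⟩ := exists_eq_pathMatching (hmorse N hN) hcard
    exact ⟨k, hk, hsub⟩
  · rintro ⟨k, -, hsub⟩
    refine ⟨pathMatching m k, hmem k, fun N hN => ?_, hsub⟩
    rw [card_pathMatching]
    exact card_le_of_isMorseMatching (hmorse N hN)

/-- for every path graph with at least three nodes, the pure discrete Morse
complex is collapsible. -/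
theorem pure_morse_complex_path_collapsible (n : ℕ) (hn : 3 ≤ n) :
    Collapsible (pureMorseComplex (graphComplex (SimpleGraph.pathGraph n))) := by
  obtain ⟨m, rfl⟩ : ∃ m, n = m + 1 := ⟨n - 1, by omega⟩
  rw [pureMorseComplex_pathGraph (by omega)]
  have hmem : ∀ k (i : Fin m), pathArc k i ∈ pathMatching m k := fun k i =>
    Finset.mem_image_of_mem _ (Finset.mem_univ i)
  have harc : ∀ (i : Fin m) (j k : ℕ), (i.val < j ↔ i.val < k) → pathArc j i = pathArc k i := by
    intro i j k h
    simp only [pathArc, h]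
  let a : ℕ → Finset (Fin (m + 1)) × Finset (Fin (m + 1)) := fun k =>
    if h : k < m then pathArc (k + 1) ⟨k, h⟩ else (∅, ∅)
  have ha : ∀ k (h : k < m), a k = pathArc (k + 1) ⟨k, h⟩ := fun k h => dif_pos h
  refine generatedComplex_collapsible (pathMatching m) a (pathArc 0 ⟨m - 1, by omega⟩) m
    (by omega) ?_ ?_ ?_ (hmem 0 _) ?_
  · intro j k hjk hkm hcon
    obtain ⟨i, -, hi⟩ := Finset.mem_image.1 hcon
    rw [ha k hkm] at hi
    obtain rfl := pathEdge_injective (congrArg Prod.fst hi)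
    have := congrArg Prod.snd hi
    simp [pathArc, Nat.not_lt.2 hjk, Fin.ext_iff] at this
  · intro k hkm p hp
    obtain ⟨hne, hp⟩ := Finset.mem_erase.1 hp
    obtain ⟨i, -, rfl⟩ := Finset.mem_image.1 hp
    have hik : i.val ≠ k := by
      rintro rfl
      exact hne (ha _ hkm).symm
    rw [harc i (k + 1) k (by omega)]
    exact hmem k i
  · intro k hkm
    rw [ha 0 (by omega), harc _ (0 + 1) (k + 1) (by simp)]
    exact hmem _ _
  · rw [harc _ 0 1 (by simp; omega)]
    exact hmem _ _
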